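/- Let A be a periodic abelian group. A nonzero central idempotent e of End A cannot be written as a sum of two nonzero orthogonal central idempotents if and only if e = e_p, the projection of A onto A_p along the other components, for some prime p with A_p ≠ 0. -/

import Mathlib

/-- The `p`-component of an abelian group: the subgroup of elements of `p`-power order. -/
def pComponent (A : Type*) [AddCommGroup A] (p : ℕ) : AddSubgroup A where
  carrier := {a | ∃ n : ℕ, p ^ n • a = 0}
  zero_mem' := ⟨0, smul_zero _⟩
  add_mem' := by
    rintro a b ⟨n, hn⟩ ⟨m, hm⟩
    refine ⟨n + m, ?_⟩
    have ha : p ^ (n + m) • a = 0 := by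
      rw [pow_add, mul_comm, mul_smul, hn, smul_zero]
    have hb : p ^ (n + m) • b = 0 := by
      rw [pow_add, mul_smul, hm, smul_zero]
    rw [smul_add, ha, hb, add_zero]
  neg_mem' := by
    rintro a ⟨n, hn⟩
    exact ⟨n, by rw [smul_neg, hn, neg_zero]⟩
section PComponent

variable {A : Type*} [AddCommGroup A] {p : ℕ}

theorem mem_pComponent {a : A} : a ∈ pComponent A p ↔ ∃ n : ℕ, p ^ n • a = 0 := Iff.rfl

theorem map_mem_pComponent (f : AddMonoid.End A) {a : A} (ha : a ∈ pComponent A p) :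
    f a ∈ pComponent A p := by
  obtain ⟨n, hn⟩ := ha
  exact ⟨n, by rw [← map_nsmul, hn, map_zero]⟩

theorem exists_pow_smul_ne_zero_of_mem_pComponent {a : A} (ha : a ∈ pComponent A p)
    (h0 : a ≠ 0) : ∃ n : ℕ, p ^ n • a ≠ 0 ∧ p • p ^ n • a = 0 := by
  classical
  have hex := mem_pComponent.1 ha
  obtain hz | hpos := Nat.eq_zero_or_pos (Nat.find hex)
  · have := Nat.find_spec hex
    rw [hz, pow_zero, one_smul] at this
    exact absurd this h0
  · refine ⟨Nat.find hex - 1, Nat.find_min hex (by omega), ?_⟩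
    rw [smul_smul, ← pow_succ', Nat.sub_add_cancel hpos]
    exact Nat.find_spec hex

/-- The homomorphism `ZMod p →+ A` sending `1` to an element killed by `p`. -/
def zmodHomOfSMulEqZero (c : A) (hc : p • c = 0) : ZMod p →+ A :=
  ZMod.lift p ⟨zmultiplesHom A c, by simpa using hc⟩

theorem zmodHomOfSMulEqZero_one (c : A) (hc : p • c = 0) : zmodHomOfSMulEqZero c hc 1 = c := by
  have h := ZMod.lift_coe p ⟨zmultiplesHom A c, by simpa using hc⟩ 1
  simpa [zmodHomOfSMulEqZero] using h

theorem zmodHomOfSMulEqZero_injective (hp : p.Prime) {c : A} (hc : p • c = 0) (h0 : c ≠ 0) :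
    Function.Injective (zmodHomOfSMulEqZero c hc) := by
  have := Fact.mk hp
  rw [injective_iff_map_eq_zero]
  intro x hx
  by_contra hne
  apply h0
  have h1 : (x⁻¹).val • x = 1 := by
    rw [nsmul_eq_mul, ZMod.natCast_zmod_val, inv_mul_cancel₀ hne]
  rw [← zmodHomOfSMulEqZero_one c hc, ← h1, map_nsmul, hx, smul_zero]

theorem exists_zmodHom_apply_eq_one (hp : p.Prime) (hA : ∀ a : A, p • a = 0) {a : A}
    (ha : a ≠ 0) : ∃ φ : A →+ ZMod p, φ a = 1 := by
  have := Fact.mk hp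
  have : Module (ZMod p) A := AddCommGroup.zmodModule hA
  obtain ⟨φ, hφ⟩ := Module.Projective.exists_dual_eq_one (ZMod p) ha
  exact ⟨φ.toAddMonoidHom, hφ⟩

theorem exists_addMonoidHom_apply_eq_of_forall_smul_ne (hp : p.Prime) {b c : A}
    (hb : ∀ a : A, p • a ≠ b) (hc : p • c = 0) : ∃ f : AddMonoid.End A, f b = c := by
  let H : AddSubgroup A := (nsmulAddMonoidHom (α := A) p).range
  have hbH : (b : A ⧸ H) ≠ 0 := by
    rw [Ne, QuotientAddGroup.eq_zero_iff]
    rintro ⟨a, ha⟩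
    exact hb a ha
  have hH : ∀ x : A ⧸ H, p • x = 0 := by
    refine QuotientAddGroup.forall_mk.2 fun a ↦ ?_
    rw [← QuotientAddGroup.mk_nsmul, QuotientAddGroup.eq_zero_iff]
    exact ⟨a, rfl⟩
  obtain ⟨φ, hφ⟩ := exists_zmodHom_apply_eq_one hp hH hbH
  exact ⟨(zmodHomOfSMulEqZero c hc).comp (φ.comp (QuotientAddGroup.mk' H)),
    (congrArg _ hφ).trans (zmodHomOfSMulEqZero_one c hc)⟩

theorem exists_zsmul_eq_of_forall_exists_smul_eq (hp : p.Prime) {B : AddSubgroup A}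
    (hB : B ≤ pComponent A p) (hdiv : ∀ b ∈ B, ∃ a ∈ B, p • a = b) {n : ℤ} (hn : n ≠ 0)
    {b : A} (hb : b ∈ B) : ∃ a ∈ B, n • a = b := by
  have hpow : ∀ k : ℕ, ∀ b ∈ B, ∃ a ∈ B, p ^ k • a = b := by
    intro k
    induction k with
    | zero => exact fun b hb ↦ ⟨b, hb, by simp⟩
    | succ k ih =>
      intro b hb
      obtain ⟨a, ha, rfl⟩ := hdiv b hb
      obtain ⟨a', ha', rfl⟩ := ih a ha
      exact ⟨a', ha', by rw [pow_succ', mul_smul]⟩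
  have hpZ : Prime (p : ℤ) := Nat.prime_iff_prime_int.1 hp
  obtain ⟨m, hm, hpm⟩ := (Int.finiteMultiplicity_iff.2
    ⟨by simpa using hp.ne_one, hn⟩ : FiniteMultiplicity (p : ℤ) n).exists_eq_pow_mul_and_not_dvd
  obtain ⟨a, ha, rfl⟩ := hpow (multiplicity (p : ℤ) n) b hb
  obtain ⟨j, hj⟩ := hB ha
  obtain ⟨u, v, huv⟩ : IsCoprime ((p : ℤ) ^ j) m :=
    ((hpZ.coprime_iff_not_dvd).2 hpm).pow_left
  have hva : m • v • a = a := by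
    have hz : ((p : ℤ) ^ j) • a = 0 := by
      rw [← hj, ← natCast_zsmul, Nat.cast_pow]
    calc m • v • a = (u * (p : ℤ) ^ j + v * m) • a := by
          rw [add_smul, mul_smul, hz, smul_zero, zero_add, smul_smul, mul_comm]
      _ = a := by rw [huv, one_smul]
  refine ⟨v • a, zsmul_mem ha v, ?_⟩
  rw [hm, mul_smul, hva, ← natCast_zsmul, Nat.cast_pow, ← hm]

theorem exists_addMonoidHom_apply_eq_of_divisible (hp : p.Prime) {B : AddSubgroup A}
    (hB : B ≤ pComponent A p) (hdiv : ∀ b ∈ B, ∃ a ∈ B, p • a = b) {b c : A} (hb : b ∈ B)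
    (hpb : p • b = 0) (hpc : p • c = 0) (hc : c ≠ 0) : ∃ f : AddMonoid.End A, f c = b := by
  let _ : DivisibleBy B ℤ := divisibleByOfSMulRightSurj B ℤ fun {n} hn x ↦ by
    obtain ⟨a, ha, h⟩ := exists_zsmul_eq_of_forall_exists_smul_eq hp hB hdiv hn x.2
    exact ⟨⟨a, ha⟩, Subtype.ext h⟩
  have hpb' : p • (⟨b, hb⟩ : B) = 0 := Subtype.ext hpb
  obtain ⟨g, hg⟩ := (Module.Baer.of_divisible B).extension_property_addMonoidHom _
    (zmodHomOfSMulEqZero_injective hp hpc hc) (zmodHomOfSMulEqZero _ hpb')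
  refine ⟨B.subtype.comp g, ?_⟩
  have h1 := DFunLike.congr_fun hg 1
  rw [AddMonoidHom.comp_apply, zmodHomOfSMulEqZero_one, zmodHomOfSMulEqZero_one] at h1
  exact congrArg Subtype.val h1

/-- A central idempotent of `End A` acts as `1` or as `0` on each primary component. -/
theorem centralIdempotent_eq_self_or_eq_zero_on_pComponent (hp : p.Prime) {e : AddMonoid.End A}
    (hid : e * e = e) (hcomm : ∀ f : AddMonoid.End A, e * f = f * e) :
    (∀ a ∈ pComponent A p, e a = a) ∨ ∀ a ∈ pComponent A p, e a = 0 := by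
  have hee : ∀ a, e (e a) = e a := fun a ↦ DFunLike.congr_fun hid a
  have hef : ∀ (f : AddMonoid.End A) a, e (f a) = f (e a) := fun f a ↦
    DFunLike.congr_fun (hcomm f) a
  by_contra! h
  obtain ⟨⟨a₁, ha₁, h₁⟩, a₂, ha₂, h₂⟩ := h
  obtain ⟨n, hc, hpc⟩ := exists_pow_smul_ne_zero_of_mem_pComponent
    (sub_mem ha₁ (map_mem_pComponent e ha₁)) (sub_ne_zero.2 h₁.symm)
  have hec : e (p ^ n • (a₁ - e a₁)) = 0 := by
    rw [map_nsmul, map_sub, hee, sub_self, smul_zero]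
  by_cases hdiv : ∀ b ∈ pComponent A p, e b = b → ∃ a, p • a = b
  · let B : AddSubgroup A := pComponent A p ⊓ AddMonoidHom.ker (e - 1 : AddMonoid.End A)
    have hmem : ∀ a, a ∈ B ↔ a ∈ pComponent A p ∧ e a = a := fun a ↦
      and_congr_right fun _ ↦ sub_eq_zero (a := e a) (b := a)
    obtain ⟨m, hb, hpb⟩ := exists_pow_smul_ne_zero_of_mem_pComponent
      (map_mem_pComponent e ha₂) h₂
    have hbB : p ^ m • e a₂ ∈ B := nsmul_mem ((hmem _).2 ⟨map_mem_pComponent e ha₂, hee _⟩) _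
    obtain ⟨f, hf⟩ := exists_addMonoidHom_apply_eq_of_divisible hp (B := B) inf_le_left
      (fun b hb ↦ by
        obtain ⟨hb₁, hb₂⟩ := (hmem b).1 hb
        obtain ⟨a, ha⟩ := hdiv b hb₁ hb₂
        obtain ⟨k, hk⟩ := hb₁
        have ha' : a ∈ pComponent A p := ⟨k + 1, by rw [pow_succ, mul_smul, ha, hk]⟩
        exact ⟨e a, (hmem _).2 ⟨map_mem_pComponent e ha', hee a⟩, by rw [← map_nsmul, ha, hb₂]⟩)
      hbB hpb hpc hc
    apply hb
    rw [← ((hmem _).1 hbB).2, ← hf, hef, hec, map_zero]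
  · push Not at hdiv
    obtain ⟨b, -, heb, hb⟩ := hdiv
    obtain ⟨f, hf⟩ := exists_addMonoidHom_apply_eq_of_forall_smul_ne hp hb hpc
    apply hc
    rw [← hf, ← heb, ← hef, hf, hec]

theorem eq_zero_of_forall_pComponent (hA : IsAddTorsion A) {g : AddMonoid.End A}
    (hg : ∀ p : ℕ, p.Prime → ∀ a ∈ pComponent A p, g a = 0) : g = 0 := by
  have key : ∀ n : ℕ, 0 < n → ∀ a : A, n • a = 0 → g a = 0 := by
    intro n
    induction n using Nat.recOnPosPrimePosCoprime with
    | prime_pow p n hp _ => exact fun _ a ha ↦ hg p hp a ⟨n, ha⟩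
    | zero => exact fun h ↦ absurd h (lt_irrefl 0)
    | one => exact fun _ a ha ↦ by rw [← one_smul ℕ a, ha, map_zero]
    | coprime m n hm hn hmn ihm ihn =>
      intro _ a ha
      have h₁ : m • g a = 0 := by
        rw [← map_nsmul]
        exact ihn (by omega) _ (by rw [smul_smul, mul_comm, ha])
      have h₂ : n • g a = 0 := by
        rw [← map_nsmul]
        exact ihm (by omega) _ (by rw [smul_smul, ha])
      exact AddMonoid.addOrderOf_eq_one_iff.1 <| Nat.eq_one_of_dvd_coprimes hmn
        (addOrderOf_dvd_of_nsmul_eq_zero h₁) (addOrderOf_dvd_of_nsmul_eq_zero h₂)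
  ext a
  obtain ⟨n, hn, ha⟩ := isOfFinAddOrder_iff_nsmul_eq_zero.1 (hA a)
  exact key n hn a ha

/-- The projection onto the `p`-component exists and is a central idempotent. -/
theorem exists_centralIdempotent_proj_pComponent (hA : IsAddTorsion A) (hp : p.Prime) :
    ∃ π : AddMonoid.End A, (π * π = π ∧ ∀ f : AddMonoid.End A, π * f = f * π) ∧
      (∀ a ∈ pComponent A p, π a = a) ∧
      ∀ q : ℕ, q.Prime → q ≠ p → ∀ a ∈ pComponent A q, π a = 0 := by
  let C : AddSubgroup A :=
    { carrier := {a | ∃ n : ℕ, p.Coprime n ∧ n • a = 0}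
      zero_mem' := ⟨1, Nat.coprime_one_right p, smul_zero _⟩
      add_mem' := by
        rintro a b ⟨n, hn, ha⟩ ⟨m, hm, hb⟩
        refine ⟨n * m, hn.mul_right hm, ?_⟩
        rw [smul_add, mul_comm, mul_smul, ha, smul_zero, mul_comm, mul_smul, hb, smul_zero,
          add_zero]
      neg_mem' := by
        rintro a ⟨n, hn, ha⟩
        exact ⟨n, hn, by rw [smul_neg, ha, neg_zero]⟩ }
  have hcompl : IsCompl (AddSubgroup.toIntSubmodule (pComponent A p))
      (AddSubgroup.toIntSubmodule C) := by
    constructor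
    · rw [Submodule.disjoint_def]
      rintro a ⟨k, hk⟩ ⟨n, hn, ha⟩
      exact AddMonoid.addOrderOf_eq_one_iff.1 <| Nat.eq_one_of_dvd_coprimes (hn.pow_left k)
        (addOrderOf_dvd_of_nsmul_eq_zero hk) (addOrderOf_dvd_of_nsmul_eq_zero ha)
    · rw [codisjoint_iff, Submodule.eq_top_iff']
      intro a
      obtain ⟨N, hN, ha⟩ := isOfFinAddOrder_iff_nsmul_eq_zero.1 (hA a)
      obtain ⟨k, m, hm, rfl⟩ := Nat.exists_eq_pow_mul_and_not_dvd hN.ne' p hp.ne_one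
      have hpm : p.Coprime m := (Nat.Prime.coprime_iff_not_dvd hp).2 hm
      obtain ⟨u, v, huv⟩ : IsCoprime ((p ^ k : ℕ) : ℤ) m :=
        Nat.isCoprime_iff_coprime.2 (hpm.pow_left k)
      refine Submodule.mem_sup.2 ⟨v • m • a, ?_, u • p ^ k • a, ?_, ?_⟩
      · exact (pComponent A p).zsmul_mem ⟨k, by rw [smul_smul, ha]⟩ v
      · exact C.zsmul_mem ⟨m, hpm, by rw [smul_smul, mul_comm, ha]⟩ u
      · rw [← natCast_zsmul, ← natCast_zsmul, smul_smul, smul_smul, ← add_smul, add_comm, huv,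
          one_smul]
  let π : AddMonoid.End A := (Submodule.projection _ _ hcompl).toAddMonoidHom
  have hπ₁ : ∀ a ∈ pComponent A p, π a = a := fun a ha ↦
    Submodule.projection_apply_of_mem_left hcompl ha
  have hπ₂ : ∀ a ∈ C, π a = 0 := fun a ha ↦ Submodule.projection_apply_of_mem_right hcompl ha
  have hmem : ∀ a, π a ∈ pComponent A p := fun a ↦ Submodule.projection_apply_mem hcompl a
  have hsub : ∀ a, a - π a ∈ C := fun a ↦
    (Submodule.projection_apply_eq_zero_iff hcompl).1 <|
      show π (a - π a) = 0 by rw [map_sub, hπ₁ _ (hmem a), sub_self]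
  refine ⟨π, ⟨?_, fun f ↦ ?_⟩, hπ₁, fun q hq hqp a ⟨n, hn⟩ ↦ hπ₂ a
    ⟨q ^ n, ((Nat.coprime_primes hp hq).2 hqp.symm).pow_right n, hn⟩⟩
  · ext a
    exact hπ₁ _ (hmem a)
  · ext a
    change π (f a) = f (π a)
    obtain ⟨n, hn, ha⟩ := hsub a
    have h : π (f (a - π a)) = 0 := hπ₂ _ ⟨n, hn, by rw [← map_nsmul, ha, map_zero]⟩
    rwa [map_sub f, map_sub π, hπ₁ _ (map_mem_pComponent f (hmem a)), sub_eq_zero] at h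

end PComponent

/-- For a periodic abelian group `A`, a nonzero central idempotent `e`
of `End A` cannot be written as a sum of two nonzero orthogonal central idempotents if
and only if `e = e_p`, the projection of `A` onto `A_p` along the other components, for
some prime `p` with `A_p ≠ 0`. -/
theorem indecomposable_centralIdempotent_iff_proj_p
    (A : Type*) [AddCommGroup A] (hA : AddMonoid.IsTorsion A) (e : AddMonoid.End A)
    (he : e ≠ 0)
    (hce : e * e = e ∧ ∀ f : AddMonoid.End A, e * f = f * e) :
    (¬ ∃ e₁ e₂ : AddMonoid.End A, e₁ ≠ 0 ∧ e₂ ≠ 0 ∧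
        (e₁ * e₁ = e₁ ∧ ∀ f : AddMonoid.End A, e₁ * f = f * e₁) ∧
        (e₂ * e₂ = e₂ ∧ ∀ f : AddMonoid.End A, e₂ * f = f * e₂) ∧
        e₁ * e₂ = 0 ∧ e₂ * e₁ = 0 ∧ e = e₁ + e₂) ↔
      ∃ p : ℕ, p.Prime ∧ pComponent A p ≠ ⊥ ∧
        (∀ a ∈ pComponent A p, e a = a) ∧
        (∀ q : ℕ, q.Prime → q ≠ p → ∀ a ∈ pComponent A q, e a = 0) := by
  have hpart : ∀ p : ℕ, p.Prime → ∀ f g : AddMonoid.End A, f ≠ 0 →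
      (f * f = f ∧ ∀ h : AddMonoid.End A, f * h = h * f) → f * g = 0 → e = f + g →
      (∀ q : ℕ, q.Prime → q ≠ p → ∀ a ∈ pComponent A q, e a = 0) →
      ∀ a ∈ pComponent A p, f a = a := by
    intro p hp f g hf hcf hfg hefg hq
    refine (centralIdempotent_eq_self_or_eq_zero_on_pComponent hp hcf.1 hcf.2).resolve_right
      fun h0 ↦ hf (eq_zero_of_forall_pComponent hA fun q hqp a ha ↦ ?_)
    obtain rfl | hne := eq_or_ne q p
    · exact h0 a ha
    · have hfe : f = f * e := by rw [hefg, mul_add, hcf.1, hfg, add_zero]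
      rw [hfe]
      change f (e a) = 0
      rw [hq q hqp hne a ha, map_zero]
  constructor
  · intro hind
    obtain ⟨p, hp, a, ha, hea⟩ : ∃ p : ℕ, p.Prime ∧ ∃ a ∈ pComponent A p, e a ≠ 0 := by
      by_contra! h
      exact he (eq_zero_of_forall_pComponent hA h)
    have hep := (centralIdempotent_eq_self_or_eq_zero_on_pComponent hp hce.1 hce.2).resolve_right
      fun h ↦ hea (h a ha)
    have ha0 : a ≠ 0 := by
      rintro rfl
      exact hea (map_zero e)
    obtain ⟨π, hπ, hπp, hπq⟩ := exists_centralIdempotent_proj_pComponent hA hp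
    have heπ : e * π = π := by
      refine sub_eq_zero.1 (eq_zero_of_forall_pComponent hA fun q hq x hx ↦ sub_eq_zero.2 ?_)
      change e (π x) = π x
      obtain rfl | hne := eq_or_ne q p
      · rw [hπp x hx, hep x hx]
      · rw [hπq q hq hne x hx, map_zero]
    have hπe : π * e = π := by rw [← hce.2, heπ]
    have hsub : e - π = 0 := by
      by_contra hne
      refine hind ⟨π, e - π, ?_, hne, hπ, ⟨?_, fun f ↦ ?_⟩, ?_, ?_, ?_⟩
      · rintro rfl
        exact ha0 (hπp a ha).symm
      · rw [sub_mul, mul_sub, mul_sub, hce.1, heπ, hπe, hπ.1, sub_self, sub_zero]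
      · rw [sub_mul, mul_sub, hce.2, hπ.2]
      · rw [mul_sub, hπe, hπ.1, sub_self]
      · rw [sub_mul, heπ, hπ.1, sub_self]
      · rw [add_sub_cancel]
    obtain rfl := sub_eq_zero.1 hsub
    refine ⟨p, hp, fun hbot ↦ ha0 ?_, hπp, hπq⟩
    rwa [hbot, AddSubgroup.mem_bot] at ha
  · rintro ⟨p, hp, hne, hep, heq⟩ ⟨e₁, e₂, h₁, h₂, hc₁, hc₂, h₁₂, h₂₁, hsum⟩
    obtain ⟨a, ha, ha0⟩ := (AddSubgroup.bot_or_exists_ne_zero (pComponent A p)).resolve_left hne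
    have h := DFunLike.congr_fun h₁₂ a
    change e₁ (e₂ a) = 0 at h
    rw [hpart p hp e₂ e₁ h₂ hc₂ h₂₁ (by rw [hsum, add_comm]) heq a ha,
      hpart p hp e₁ e₂ h₁ hc₁ h₁₂ hsum heq a ha] at h
    exact ha0 h
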